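/- Let f be convex and L-smooth on a real inner product space, let δ ∈ (0,1), let h satisfy (3δ+2-√(4-3δ²))/(2δ(δ+1)) ≤ h < 2/(1+δ), and let x1 = x0 - (h/L)·d0 where d0 satisfies ‖d0 - ∇f(x0)‖ ≤ δ‖∇f(x0)‖. Then (1/L)·‖∇f(x1)‖² ≤ (2(1-h(1+δ))² / (h(1+δ)(2 - h(1+δ)))) · (f(x0) - f(x1)). (The rate equals 2/((1-h(1+δ))^{-2} - 1).) -/

import Mathlib

open scoped InnerProductSpace in
lemma aux_line {H : Type*} [NormedAddCommGroup H] [InnerProductSpace ℝ H] [CompleteSpace H]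
    (f : H → ℝ) (f' : H → H) (hgrad : ∀ x, HasGradientAt f (f' x) x) (x v : H) (t : ℝ) :
    HasDerivAt (fun s : ℝ => f (x + s • v)) (⟪f' (x + t • v), v⟫_ℝ) t := by
  have h1 : HasDerivAt (fun s : ℝ => x + s • v) v t := by
    simpa using ((hasDerivAt_id t).smul_const v).const_add x
  have h2 := (hgrad (x + t • v)).hasFDerivAt.comp_hasDerivAt t h1
  simp at h2
  exact h2

open scoped InnerProductSpace in
lemma aux_convex {H : Type*} [NormedAddCommGroup H] [InnerProductSpace ℝ H] [CompleteSpace H]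
    (f : H → ℝ) (f' : H → H) (hconv : ConvexOn ℝ Set.univ f)
    (hgrad : ∀ x, HasGradientAt f (f' x) x) (x y : H) :
    f x + ⟪f' x, y - x⟫_ℝ ≤ f y := by
  have hc : ConvexOn ℝ Set.univ (fun s : ℝ => f (x + s • (y - x))) := by
    have := hconv.comp_affineMap (AffineMap.lineMap x y : ℝ →ᵃ[ℝ] H)
    simpa [Function.comp_def, AffineMap.lineMap_apply, add_comm] using this
  have h1 := hc.le_slope_of_hasDerivAt (x := 0) (y := 1) (Set.mem_univ _) (Set.mem_univ _)
    (by norm_num) (aux_line f f' hgrad x (y - x) 0)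
  simp [slope_def_field] at h1
  linarith

open scoped InnerProductSpace in
lemma aux_descent {H : Type*} [NormedAddCommGroup H] [InnerProductSpace ℝ H] [CompleteSpace H]
    (f : H → ℝ) (f' : H → H) (L : ℝ) (hL : 0 < L)
    (hgrad : ∀ x, HasGradientAt f (f' x) x) (hlip : LipschitzWith L.toNNReal f') (y v : H) :
    f (y + v) ≤ f y + ⟪f' y, v⟫_ℝ + L / 2 * ‖v‖ ^ 2 := by
  have hd : ∀ t : ℝ, HasDerivAt
      (fun s : ℝ => f (y + s • v) - s * ⟪f' y, v⟫_ℝ - s ^ 2 * (L / 2 * ‖v‖ ^ 2))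
      (⟪f' (y + t • v), v⟫_ℝ - ⟪f' y, v⟫_ℝ - 2 * t * (L / 2 * ‖v‖ ^ 2)) t := by
    intro t
    have h1 := (aux_line f f' hgrad y v t).sub ((hasDerivAt_id t).mul_const ⟪f' y, v⟫_ℝ)
    have h2 := h1.sub ((hasDerivAt_pow 2 t).mul_const (L / 2 * ‖v‖ ^ 2))
    simp at h2
    exact h2
  have hanti : AntitoneOn
      (fun s : ℝ => f (y + s • v) - s * ⟪f' y, v⟫_ℝ - s ^ 2 * (L / 2 * ‖v‖ ^ 2))
      (Set.Ici 0) := by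
    apply antitoneOn_of_deriv_nonpos (convex_Ici 0)
    · exact fun t _ => (hd t).continuousAt.continuousWithinAt
    · exact fun t _ => (hd t).differentiableAt.differentiableWithinAt
    · intro t ht
      rw [interior_Ici] at ht
      have ht : 0 < t := ht
      rw [(hd t).deriv, ← inner_sub_left]
      have h1 := real_inner_le_norm (f' (y + t • v) - f' y) v
      have h2 := hlip.norm_sub_le (y + t • v) y
      rw [Real.coe_toNNReal L hL.le, add_sub_cancel_left, norm_smul, Real.norm_eq_abs,
        abs_of_pos ht] at h2
      have h3 := mul_le_mul_of_nonneg_right h2 (norm_nonneg v)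
      nlinarith
  have := hanti (a := 0) (b := 1) (by simp) (by simp) (by norm_num)
  simp at this
  linarith

open scoped InnerProductSpace in
lemma aux_interp {H : Type*} [NormedAddCommGroup H] [InnerProductSpace ℝ H] [CompleteSpace H]
    (f : H → ℝ) (f' : H → H) (L : ℝ) (hL : 0 < L) (hconv : ConvexOn ℝ Set.univ f)
    (hgrad : ∀ x, HasGradientAt f (f' x) x) (hlip : LipschitzWith L.toNNReal f') (x y : H) :
    L * ⟪f' x, y - x⟫_ℝ + 1 / 2 * ‖f' y - f' x‖ ^ 2 ≤ L * (f y - f x) := by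
  have h1 := aux_descent f f' L hL hgrad hlip y (-(1 / L) • (f' y - f' x))
  have h2 := aux_convex f f' hconv hgrad x (y + -(1 / L) • (f' y - f' x))
  have h3 : ⟪f' x, y + -(1 / L) • (f' y - f' x) - x⟫_ℝ
      = ⟪f' x, y - x⟫_ℝ - 1 / L * ⟪f' x, f' y - f' x⟫_ℝ := by
    rw [add_sub_right_comm, inner_add_right, inner_smul_right]; ring
  have h4 : ⟪f' y, f' y - f' x⟫_ℝ - ⟪f' x, f' y - f' x⟫_ℝ = ‖f' y - f' x‖ ^ 2 := by
    rw [← inner_sub_left, real_inner_self_eq_norm_sq]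
  rw [h3] at h2
  rw [inner_smul_right, norm_smul, mul_pow, Real.norm_eq_abs, sq_abs] at h1
  have h5 := mul_le_mul_of_nonneg_left (h2.trans h1) hL.le
  have e1 : L * (f x + (⟪f' x, y - x⟫_ℝ - 1 / L * ⟪f' x, f' y - f' x⟫_ℝ))
    = L * f x + L * ⟪f' x, y - x⟫_ℝ - ⟪f' x, f' y - f' x⟫_ℝ := by field_simp; ring
  have e2 : L * (f y + -(1 / L) * ⟪f' y, f' y - f' x⟫_ℝ
      + L / 2 * ((-(1 / L)) ^ 2 * ‖f' y - f' x‖ ^ 2))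
    = L * f y - ⟪f' y, f' y - f' x⟫_ℝ + 1 / 2 * ‖f' y - f' x‖ ^ 2 := by field_simp; ring
  rw [e1, e2] at h5
  linarith

lemma aux_range (δ h : ℝ) (hδ : δ ∈ Set.Ioo (0 : ℝ) 1)
    (hlb : (3 * δ + 2 - Real.sqrt (4 - 3 * δ ^ 2)) / (2 * δ * (δ + 1)) ≤ h)
    (hub : h < 2 / (1 + δ)) :
    0 < h ∧ 1 < h * (1 + δ) ∧ h * (1 + δ) < 2 ∧
      δ * h * (h * (1 + δ) - 1) ≤ 2 * (h * (1 + δ)) - 3 := by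
  obtain ⟨h0, h1⟩ := hδ
  have hu : h * (1 + δ) < 2 := by rwa [lt_div_iff₀ (by linarith)] at hub
  have hl : 3 * δ + 2 - Real.sqrt (4 - 3 * δ ^ 2) ≤ h * (2 * δ * (δ + 1)) := by
    rwa [div_le_iff₀ (by positivity)] at hlb
  have hs : Real.sqrt (4 - 3 * δ ^ 2) ^ 2 = 4 - 3 * δ ^ 2 :=
    Real.sq_sqrt (by nlinarith)
  have hs0 := Real.sqrt_nonneg (4 - 3 * δ ^ 2)
  set s := Real.sqrt (4 - 3 * δ ^ 2)
  have hs2 : s ≤ 2 := by nlinarith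
  have hs1 : 2 - δ < s := by nlinarith
  generalize hη : h * (1 + δ) = η at *
  have hl' : 3 * δ + 2 - s ≤ 2 * δ * η := by rw [← hη]; linarith
  have hη1 : 1 < η := by nlinarith
  have hh : 0 < h := by
    by_contra hc
    nlinarith
  refine ⟨hh, hη1, hu, ?_⟩
  have hq : δ * η ^ 2 - (3 * δ + 2) * η + 3 * (1 + δ) ≤ 0 := by
    have : 0 ≤ (2 * δ * η - (3 * δ + 2 - s)) * (3 * δ + 2 + s - 2 * δ * η) :=
      mul_nonneg (by linarith) (by nlinarith)
    by_contra hc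
    push Not at hc
    have := mul_pos h0 hc
    nlinarith
  have : (1 + δ) * (δ * h * (η - 1)) ≤ (1 + δ) * (2 * η - 3) := by
    have : (1 + δ) * (δ * h * (η - 1)) = δ * η * (η - 1) := by rw [← hη]; ring
    rw [this]; nlinarith
  exact le_of_mul_le_mul_left this (by linarith)

/-- One step of relatively inexact gradient descent (inexactness `δ ∈ (0,1)`)
on a convex `L`-smooth function, right regime
`(3δ+2-√(4-3δ²))/(2δ(δ+1)) ≤ h < 2/(1+δ)`:
`(1/L)·‖∇f(x1)‖² ≤ (2(1-h(1+δ))²/(h(1+δ)(2-h(1+δ)))) · (f(x0) - f(x1))`. -/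
theorem one_step_inexact_gd_right_regime
    {H : Type*} [NormedAddCommGroup H] [InnerProductSpace ℝ H] [CompleteSpace H]
    (f : H → ℝ) (f' : H → H) (L : ℝ) (hL : 0 < L)
    (hconv : ConvexOn ℝ Set.univ f)
    (hgrad : ∀ x, HasGradientAt f (f' x) x)
    (hlip : LipschitzWith L.toNNReal f')
    (δ : ℝ) (hδ : δ ∈ Set.Ioo (0 : ℝ) 1)
    (h : ℝ)
    (hlb : (3 * δ + 2 - Real.sqrt (4 - 3 * δ ^ 2)) / (2 * δ * (δ + 1)) ≤ h)
    (hub : h < 2 / (1 + δ))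
    (x0 d0 x1 : H)
    (hd0 : ‖d0 - f' x0‖ ≤ δ * ‖f' x0‖)
    (hx1 : x1 = x0 - (h / L) • d0) :
    (1 / L) * ‖f' x1‖ ^ 2 ≤
      (2 * (1 - h * (1 + δ)) ^ 2 / (h * (1 + δ) * (2 - h * (1 + δ)))) * (f x0 - f x1) := by
  obtain ⟨hh, hη1, hη2, hc⟩ := aux_range δ h hδ hlb hub
  obtain ⟨hδ0, hδ1⟩ := hδ
  have hA := aux_interp f f' L hL hconv hgrad hlip x1 x0
  have hB := aux_interp f f' L hL hconv hgrad hlip x0 x1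
  have v1 : x0 - x1 = (h / L) • d0 := by rw [hx1]; abel
  have v2 : x1 - x0 = -((h / L) • d0) := by rw [hx1]; abel
  rw [v1, inner_smul_right] at hA
  rw [v2, inner_neg_right, inner_smul_right] at hB
  have eA : L * (h / L * inner ℝ (f' x1) d0) = h * inner ℝ (f' x1) d0 := by field_simp
  have eB : L * -(h / L * inner ℝ (f' x0) d0) = -(h * inner ℝ (f' x0) d0) := by field_simp
  rw [eA] at hA
  rw [eB] at hB
  have hD : ‖d0 - f' x0‖ ^ 2 ≤ δ ^ 2 * ‖f' x0‖ ^ 2 := by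
    rw [← mul_pow]; exact pow_le_pow_left₀ (norm_nonneg _) hd0 2
  obtain ⟨p, hp⟩ : ∃ p, d0 = (1 + δ) • f' x0 + p := ⟨d0 - (1 + δ) • f' x0, by abel⟩
  obtain ⟨q, hq⟩ : ∃ q, f' x1 = (1 - h * (1 + δ)) • f' x0 + q :=
    ⟨f' x1 - (1 - h * (1 + δ)) • f' x0, by abel⟩
  have hP : 0 ≤ ‖p + δ • q‖ ^ 2 := by positivity
  have hQ : 0 ≤ ‖q‖ ^ 2 := by positivity
  have key : (h * (1 + δ) * (2 - h * (1 + δ))) * ‖f' x1‖ ^ 2 ≤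
      2 * (1 - h * (1 + δ)) ^ 2 * (L * (f x0 - f x1)) := by
    rw [hq, hp] at hA hB
    rw [hp] at hD
    rw [hq]
    generalize f' x0 = g at *
    simp only [← real_inner_self_eq_norm_sq, inner_add_left, inner_add_right, inner_sub_left,
      inner_sub_right, real_inner_smul_left, real_inner_smul_right, real_inner_comm g p,
      real_inner_comm g q, real_inner_comm p q] at *
    have m1 := mul_le_mul_of_nonneg_left hA (show 0 ≤ δ * (2 * (h * (1 + δ) - 1)) by
      apply mul_nonneg <;> linarith)
    have m2 := mul_le_mul_of_nonneg_left hB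
      (show 0 ≤ δ * (2 * (h * (1 + δ) - 1) * (2 - h * (1 + δ))) by
        apply mul_nonneg hδ0.le; apply mul_nonneg <;> linarith)
    have m3 := mul_le_mul_of_nonneg_left hD (show 0 ≤ h * (h * (1 + δ) - 1) by
      apply mul_nonneg <;> linarith)
    have m4 := mul_nonneg (show 0 ≤ h * (h * (1 + δ) - 1) by
      apply mul_nonneg <;> linarith) hP
    have m5 := mul_nonneg (mul_nonneg hδ0.le (sub_nonneg.2 hc)) hQ
    refine le_of_mul_le_mul_left ?_ hδ0
    linear_combination m1 + m2 + m3 + m4 + m5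
  have hpos : 0 < h * (1 + δ) * (2 - h * (1 + δ)) := mul_pos (by linarith) (by linarith)
  rw [one_div, inv_mul_eq_div, div_le_iff₀ hL, div_mul_eq_mul_div, div_mul_eq_mul_div,
    le_div_iff₀ hpos]
  linarith
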